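/- Let α ∈ (0,1) and let J be an instance in which every job is α-loose, i.e., p_j ≤ α·(d_j − r_j) for all j ∈ J, and suppose J admits a feasible preemptive schedule on m machines. Then for every integer m′ ≥ m/(1−α)², the EDF schedule of J on m′ machines completes every job by its deadline (i.e., every job j is processed in exactly p_j slots t with r_j ≤ t < d_j). -/

import Mathlib

/-- A job with release date `r`, deadline `d`, and processing time `p`. -/
structure Job where
  r : ℕ
  d : ℕ
  p : ℕ

/-- A job is valid if `1 ≤ p` and `p ≤ d - r` (i.e. `r + p ≤ d`). -/
def Job.valid (j : Job) : Prop := 1 ≤ j.p ∧ j.r + j.p ≤ j.d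

/-- The laxity `ℓ_j = d_j - r_j - p_j` of a job. -/
def Job.lax (j : Job) : ℕ := j.d - j.r - j.p

/-- A preemptive schedule of the instance `J` is feasible on `m` machines if at most `m`
jobs are processed in every slot, every job is only processed inside its window, and
every job is processed for exactly `p_j` slots. -/
def FeasiblePre {n : ℕ} (J : Fin n → Job) (m : ℕ) : Prop :=
  ∃ S : ℕ → Finset (Fin n),
    (∀ t, (S t).card ≤ m) ∧
    (∀ t j, j ∈ S t → (J j).r ≤ t ∧ t < (J j).d) ∧
    (∀ j, ((Finset.range (J j).d).filter (fun t => j ∈ S t)).card = (J j).p)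

/-- The minimum number of machines on which `J` admits a feasible preemptive schedule. -/
noncomputable def mOpt {n : ℕ} (J : Fin n → Job) : ℕ := sInf {m | FeasiblePre J m}

/-- From the set `A`, select the (at most) `m'` smallest elements w.r.t. the
(irreflexive, total) order `lt`. -/
def select {n : ℕ} (m' : ℕ) (lt : Fin n → Fin n → Prop) [DecidableRel lt]
    (A : Finset (Fin n)) : Finset (Fin n) :=
  A.filter (fun j => (A.filter fun k => lt k j).card < m')

/-- EDF priority: smaller deadline first, ties broken by earlier release date,
then by lower index. -/
def edfLt {n : ℕ} (J : Fin n → Job) (a b : Fin n) : Prop :=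
  (J a).d < (J b).d ∨
    ((J a).d = (J b).d ∧
      ((J a).r < (J b).r ∨ ((J a).r = (J b).r ∧ a < b)))

instance {n : ℕ} (J : Fin n → Job) : DecidableRel (edfLt J) := fun a b => by
  unfold edfLt; infer_instance

/-- The set of active jobs at time `t`, given that job `j` has been processed for
`c j` slots so far: released and not yet finished. -/
def activeSet {n : ℕ} (J : Fin n → Job) (c : Fin n → ℕ) (t : ℕ) : Finset (Fin n) :=
  Finset.univ.filter (fun j => (J j).r ≤ t ∧ c j < (J j).p)

/-- `edfCnt J m' t j` is the number of slots before time `t` in which the EDF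
schedule on `m'` machines processes job `j`. -/
def edfCnt {n : ℕ} (J : Fin n → Job) (m' : ℕ) : ℕ → Fin n → ℕ
  | 0 => fun _ => 0
  | t + 1 => fun j =>
      edfCnt J m' t j +
        (if j ∈ select m' (edfLt J) (activeSet J (edfCnt J m' t) t) then 1 else 0)

/-- The set of jobs processed in slot `t` by EDF on `m'` machines: the
(at most `m'`) active jobs with smallest deadlines (ties by release date, then index). -/
def edfSched {n : ℕ} (J : Fin n → Job) (m' : ℕ) (t : ℕ) : Finset (Fin n) :=
  select m' (edfLt J) (activeSet J (edfCnt J m' t) t)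

/-- The number of slots before time `t` in which the schedule `S` processes job `j`. -/
def slotCount {n : ℕ} (S : ℕ → Finset (Fin n)) (t : ℕ) (j : Fin n) : ℕ :=
  ((Finset.range t).filter (fun s => j ∈ S s)).card

/-- The work the schedule `S` spends on the jobs of `K` before time `t`. -/
def workDone {n : ℕ} (S : ℕ → Finset (Fin n)) (K : Finset (Fin n)) (t : ℕ) : ℕ :=
  ∑ k ∈ K, slotCount S t k

/-- The jobs of `J` with deadline at most `d`. -/
def dueBy {n : ℕ} (J : Fin n → Job) (d : ℕ) : Finset (Fin n) :=
  Finset.univ.filter (fun k => (J k).d ≤ d)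

theorem slotCount_succ {n : ℕ} (S : ℕ → Finset (Fin n)) (t : ℕ) (j : Fin n) :
    slotCount S (t + 1) j = slotCount S t j + if j ∈ S t then 1 else 0 := by
  unfold slotCount
  rw [Finset.range_add_one, Finset.filter_insert]
  split_ifs <;> simp

theorem slotCount_mono {n : ℕ} (S : ℕ → Finset (Fin n)) (j : Fin n) :
    Monotone (fun t => slotCount S t j) :=
  monotone_nat_of_le_succ fun t => by rw [slotCount_succ]; omega

theorem workDone_succ {n : ℕ} (S : ℕ → Finset (Fin n)) (K : Finset (Fin n)) (t : ℕ) :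
    workDone S K (t + 1) = workDone S K t + (K ∩ S t).card := by
  unfold workDone
  simp_rw [slotCount_succ]
  rw [Finset.sum_add_distrib, Finset.sum_ite_mem]
  simp

theorem slotCount_eq_zero_of_le {n : ℕ} {S : ℕ → Finset (Fin n)} {r t : ℕ} {j : Fin n}
    (h : ∀ s, j ∈ S s → r ≤ s) (ht : t ≤ r) : slotCount S t j = 0 := by
  unfold slotCount
  rw [Finset.card_eq_zero, Finset.filter_eq_empty_iff]
  intro s hs hj
  have := h s hj
  have := Finset.mem_range.1 hs
  omega

theorem slotCount_le_of_deadline {n : ℕ} {S : ℕ → Finset (Fin n)} {d : ℕ} {j : Fin n}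
    (h : ∀ s, j ∈ S s → s < d) (t : ℕ) : slotCount S t j ≤ slotCount S d j := by
  refine Finset.card_le_card fun s hs => ?_
  rw [Finset.mem_filter] at hs ⊢
  exact ⟨Finset.mem_range.2 (h s hs.2), hs.2⟩

theorem edfCnt_eq_slotCount {n : ℕ} (J : Fin n → Job) (m' t : ℕ) (j : Fin n) :
    edfCnt J m' t j = slotCount (edfSched J m') t j := by
  induction t with
  | zero => simp [edfCnt, slotCount]
  | succ t ih => rw [slotCount_succ, ← ih]; rfl

theorem mem_activeSet_of_mem_edfSched {n : ℕ} {J : Fin n → Job} {m' t : ℕ} {j : Fin n}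
    (h : j ∈ edfSched J m' t) : (J j).r ≤ t ∧ slotCount (edfSched J m') t j < (J j).p := by
  have h1 := (Finset.mem_filter.1 h).1
  simpa [activeSet, edfCnt_eq_slotCount] using h1

theorem slotCount_edfSched_le {n : ℕ} (J : Fin n → Job) (m' t : ℕ) (j : Fin n) :
    slotCount (edfSched J m') t j ≤ (J j).p := by
  induction t with
  | zero => simp [slotCount]
  | succ t ih =>
    rw [slotCount_succ]
    split_ifs with h
    · exact (mem_activeSet_of_mem_edfSched h).2
    · simpa using ih

theorem edfLt_trans {n : ℕ} {J : Fin n → Job} {a b c : Fin n}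
    (hab : edfLt J a b) (hbc : edfLt J b c) : edfLt J a c := by
  unfold edfLt at *
  omega

theorem edfLt_irrefl {n : ℕ} (J : Fin n → Job) (a : Fin n) : ¬ edfLt J a a := by
  simp [edfLt]

theorem le_of_edfLt {n : ℕ} {J : Fin n → Job} {a b : Fin n} (h : edfLt J a b) :
    (J a).d ≤ (J b).d := by
  unfold edfLt at h
  omega

/-- In a finite strict partial order with at least `m` elements, at least `m` elements have
fewer than `m` predecessors. -/
theorem le_card_select {n : ℕ} (m : ℕ) (lt : Fin n → Fin n → Prop) [DecidableRel lt]
    (htrans : ∀ a b c, lt a b → lt b c → lt a c) (hirrefl : ∀ a, ¬ lt a a)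
    (B : Finset (Fin n)) (hB : m ≤ B.card) : m ≤ (select m lt B).card := by
  induction hs : B.card - m generalizing B with
  | zero =>
    have : select m lt B = B := by
      refine Finset.filter_true_of_mem fun b hb => ?_
      have : (B.filter fun k => lt k b).card < B.card :=
        Finset.card_lt_card (Finset.filter_ssubset.2 ⟨b, hb, hirrefl b⟩)
      omega
    rwa [this]
  | succ k ih =>
    have hne : (B : Set (Fin n)).Nonempty := by
      rw [Finset.coe_nonempty, ← Finset.card_pos]
      omega
    have : IsTrans (Fin n) (Function.swap lt) := ⟨fun a b c h1 h2 => htrans c b a h2 h1⟩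
    have : Std.Irrefl (Function.swap lt) := ⟨hirrefl⟩
    have hwf := Finite.wellFounded_of_trans_of_irrefl (Function.swap lt)
    obtain ⟨x, hx, hmax⟩ := hwf.has_min (B : Set (Fin n)) hne
    have hcard := Finset.card_erase_of_mem (Finset.mem_coe.1 hx)
    refine (ih (B.erase x) (by omega) (by omega)).trans (Finset.card_le_card fun b hb => ?_)
    rw [select, Finset.mem_filter] at hb ⊢
    have hbB := Finset.mem_of_mem_erase hb.1
    refine ⟨hbB, ?_⟩
    have hxb : x ∉ B.filter fun k => lt k b := fun h => hmax b hbB (Finset.mem_filter.1 h).2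
    rw [Finset.filter_erase, Finset.erase_eq_of_notMem hxb] at hb
    exact hb.2

/-- If EDF delays an active job due by `d`, then it runs `m'` jobs due by `d`. -/
theorem le_card_of_notMem_edfSched {n : ℕ} {J : Fin n → Job} {m' t d : ℕ} {j : Fin n}
    (hd : (J j).d ≤ d) (hr : (J j).r ≤ t) (hp : slotCount (edfSched J m') t j < (J j).p)
    (hj : j ∉ edfSched J m' t) : m' ≤ (dueBy J d ∩ edfSched J m' t).card := by
  set A := activeSet J (edfCnt J m' t) t with hA
  have hjA : j ∈ A := by simp [hA, activeSet, edfCnt_eq_slotCount, hr, hp]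
  have hB : m' ≤ (A.filter fun k => edfLt J k j).card := by
    by_contra! h
    exact hj (Finset.mem_filter.2 ⟨hjA, h⟩)
  refine (le_card_select m' (edfLt J) (fun _ _ _ => edfLt_trans) (edfLt_irrefl J) _ hB).trans
    (Finset.card_le_card fun b hb => ?_)
  rw [select, Finset.mem_filter, Finset.mem_filter] at hb
  obtain ⟨⟨hbA, hbj⟩, hb⟩ := hb
  refine Finset.mem_inter.2 ⟨?_, Finset.mem_filter.2 ⟨hbA, ?_⟩⟩
  · simpa [dueBy] using (le_of_edfLt hbj).trans hd
  · rw [Finset.filter_filter] at hb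
    convert hb using 4 with k
    exact ⟨fun h => ⟨edfLt_trans h hbj, h⟩, fun h => h.2⟩

/-- While a job `j` due by `d` is unfinished, EDF processes at least `m'` jobs due by `d` in every
slot that does not process `j`. -/
theorem workDone_edfSched_ge {n : ℕ} {J : Fin n → Job} {m' d : ℕ} {j : Fin n}
    (hd : (J j).d ≤ d) (t : ℕ)
    (hp : slotCount (edfSched J m') ((J j).r + t) j < (J j).p) :
    workDone (edfSched J m') (dueBy J d) (J j).r + m' * t ≤
      workDone (edfSched J m') (dueBy J d) ((J j).r + t) +
        m' * slotCount (edfSched J m') ((J j).r + t) j := by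
  induction t with
  | zero => simp
  | succ t ih =>
    have hp' : slotCount (edfSched J m') ((J j).r + t) j < (J j).p :=
      (slotCount_mono _ j (by omega : (J j).r + t ≤ (J j).r + (t + 1))).trans_lt hp
    have := ih hp'
    rw [← add_assoc, workDone_succ, slotCount_succ]
    split_ifs with h
    · rw [mul_add, mul_add]
      omega
    · have := le_card_of_notMem_edfSched hd (by omega) hp' h
      rw [mul_add, add_zero]
      omega

theorem workDone_add_le {n : ℕ} {S : ℕ → Finset (Fin n)} {m : ℕ} (hS : ∀ t, (S t).card ≤ m)
    (K : Finset (Fin n)) (s t : ℕ) : workDone S K (s + t) ≤ workDone S K s + m * t := by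
  induction t with
  | zero => simp
  | succ t ih =>
    have := (Finset.card_le_card (Finset.inter_subset_right (s₁ := K) (s₂ := S (s + t)))).trans
      (hS (s + t))
    rw [← add_assoc, workDone_succ, mul_add]
    omega

/-- EDF lags behind any feasible schedule on `m` machines by at most `α / (1 - α) * m * (d - t)`
units of work on the jobs due by `d`. -/
theorem workDone_sub_edfSched_le {n : ℕ} {J : Fin n → Job} {α : ℚ} (hα0 : 0 < α) (hα1 : α < 1)
    (hloose : ∀ j, ((J j).p : ℚ) ≤ α * (((J j).d : ℚ) - ((J j).r : ℚ)))
    {S : ℕ → Finset (Fin n)} {m m' : ℕ} (hS : ∀ t, (S t).card ≤ m)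
    (hwin : ∀ t j, j ∈ S t → (J j).r ≤ t ∧ t < (J j).d)
    (hp : ∀ j, slotCount S (J j).d j = (J j).p)
    (hm' : (m : ℚ) ≤ m' * (1 - α) ^ 2) (d t : ℕ) (ht : t ≤ d) :
    (1 - α) * ((workDone S (dueBy J d) t : ℚ) - workDone (edfSched J m') (dueBy J d) t) ≤
      α * m * ((d : ℚ) - t) := by
  induction t using Nat.strong_induction_on with
  | _ t ih =>
  obtain _ | t := t
  · simp only [workDone, slotCount]
    simp
    positivity
  have h1α : 0 < 1 - α := by linarith
  have htd : (t : ℚ) + 1 ≤ d := by exact_mod_cast ht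
  set K := dueBy J d with hK
  set E := edfSched J m' with hE
  by_cases hbusy : (m : ℚ) ≤ (1 - α) * (K ∩ E t).card
  · have h1 := ih t (by omega) (by omega)
    have h2 := workDone_add_le hS K t 1
    rw [workDone_succ E]
    have h2' : (workDone S K (t + 1) : ℚ) ≤ workDone S K t + m := by
      exact_mod_cast (by simpa using h2)
    have h3 := mul_le_mul_of_nonneg_left h2' h1α.le
    push_cast
    linarith
  push Not at hbusy
  have hactive : ∀ k ∈ K, (J k).r ≤ t → slotCount E t k < (J k).p → k ∈ E t := by
    intro k hk hr hlt
    by_contra hnot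
    have h1 : m' ≤ (K ∩ E t).card :=
      le_card_of_notMem_edfSched (Finset.mem_filter.1 hk).2 hr hlt hnot
    have h2 : (m' : ℚ) ≤ (K ∩ E t).card := by exact_mod_cast h1
    have h3 := mul_le_mul_of_nonneg_left h2 h1α.le
    have h4 : 0 ≤ (m' : ℚ) * (1 - α) * α := by positivity
    linarith
  have hxp : ∀ k, slotCount S (t + 1) k ≤ (J k).p := fun k =>
    (slotCount_le_of_deadline (fun s hs => (hwin s k hs).2) _).trans (hp k).le
  have hlag : ∀ k, slotCount E (t + 1) k < slotCount S (t + 1) k → (J k).r ≤ t := by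
    intro k hk
    by_contra! h
    have := slotCount_eq_zero_of_le (t := t + 1) (fun s hs => (hwin s k hs).1) h
    omega
  by_cases hslow : ∃ k ∈ K, slotCount E (t + 1) k < slotCount S (t + 1) k ∧
      (slotCount E (t + 1) k : ℚ) ≤ α * ((t : ℚ) + 1 - (J k).r)
  · obtain ⟨k, hk, hlt, hle⟩ := hslow
    have hr := hlag k hlt
    obtain ⟨u, hu⟩ := Nat.exists_eq_add_of_le (show (J k).r ≤ t + 1 by omega)
    have h1 := ih (J k).r (by omega) (by omega)
    have h2 := workDone_add_le hS K (J k).r u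
    have h3 := workDone_edfSched_ge (m' := m') (Finset.mem_filter.1 hk).2 u
      (by rw [← hu]; exact hlt.trans_le (hxp k))
    rw [← hu] at h2 h3
    have hu' : (t : ℚ) + 1 = (J k).r + u := by exact_mod_cast hu
    have h2' : (workDone S K (t + 1) : ℚ) ≤ workDone S K (J k).r + m * u := by exact_mod_cast h2
    have h3' : (workDone E K (J k).r : ℚ) + m' * u ≤
        workDone E K (t + 1) + m' * slotCount E (t + 1) k := by exact_mod_cast h3
    have h4 : (slotCount E (t + 1) k : ℚ) ≤ α * u := by
      rw [hu'] at hle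
      linarith
    have h5 := mul_le_mul_of_nonneg_left h4 (Nat.cast_nonneg (α := ℚ) m')
    have h6 : (workDone S K (t + 1) : ℚ) - workDone E K (t + 1) ≤
        workDone S K (J k).r - workDone E K (J k).r + m * u - m' * (1 - α) * u := by linarith
    have h7 := mul_le_mul_of_nonneg_left h6 h1α.le
    have h8 := mul_le_mul_of_nonneg_right hm' (Nat.cast_nonneg (α := ℚ) u)
    push_cast
    rw [hu']
    linarith
  · push Not at hslow
    have hrem : 0 ≤ α * ((d : ℚ) - (t + 1)) := mul_nonneg hα0.le (by linarith)
    have hterm : ∀ k ∈ K, (slotCount S (t + 1) k : ℚ) - slotCount E (t + 1) k ≤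
        if k ∈ E t then α * ((d : ℚ) - (t + 1)) else 0 := by
      intro k hk
      by_cases hlt : slotCount E (t + 1) k < slotCount S (t + 1) k
      · have h0 := slotCount_mono E k (Nat.le_succ t)
        rw [if_pos (hactive k hk (hlag k hlt) (h0.trans_lt (hlt.trans_le (hxp k))))]
        have h1 := hslow k hk hlt
        have h2 : (slotCount S (t + 1) k : ℚ) ≤ (J k).p := by exact_mod_cast hxp k
        have h3 : ((J k).d : ℚ) ≤ d := by exact_mod_cast (Finset.mem_filter.1 hk).2
        have h4 := mul_le_mul_of_nonneg_left h3 hα0.le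
        have h5 := hloose k
        linarith
      · have h1 : (slotCount S (t + 1) k : ℚ) ≤ slotCount E (t + 1) k := by
          exact_mod_cast not_lt.1 hlt
        split_ifs <;> linarith
    have hsum := Finset.sum_le_sum hterm
    rw [Finset.sum_sub_distrib, Finset.sum_ite_mem, Finset.sum_const, nsmul_eq_mul] at hsum
    have h1 := mul_le_mul_of_nonneg_left hsum h1α.le
    have h2 := mul_le_mul_of_nonneg_right hbusy.le hrem
    unfold workDone
    push_cast
    linarith

theorem card_filter_Ico_edfSched {n : ℕ} (J : Fin n → Job) (m' : ℕ) (j : Fin n) :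
    ((Finset.Ico (J j).r (J j).d).filter (fun t => j ∈ edfSched J m' t)).card =
      slotCount (edfSched J m') (J j).d j := by
  unfold slotCount
  congr 1
  ext t
  simp only [Finset.mem_filter, Finset.mem_Ico, Finset.mem_range]
  exact ⟨fun h => ⟨h.1.2, h.2⟩, fun h => ⟨⟨(mem_activeSet_of_mem_edfSched h.2).1, h.1⟩, h.2⟩⟩

/-- If every job of `J` is `α`-loose (`p_j ≤ α(d_j - r_j)`) and `J`
admits a feasible preemptive schedule on `m` machines, then for every
`m' ≥ m/(1-α)²` the EDF schedule of `J` on `m'` machines completes every job by its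
deadline: every job is processed in exactly `p_j` slots `t` with `r_j ≤ t < d_j`. -/
theorem edf_loose_competitive {n : ℕ} (J : Fin n → Job) (hval : ∀ j, (J j).valid)
    (α : ℚ) (hα0 : 0 < α) (hα1 : α < 1)
    (hloose : ∀ j, ((J j).p : ℚ) ≤ α * (((J j).d : ℚ) - ((J j).r : ℚ)))
    (m : ℕ) (hm : FeasiblePre J m)
    (m' : ℕ) (hm' : (m : ℚ) / (1 - α) ^ 2 ≤ (m' : ℚ)) :
    ∀ j, ((Finset.Ico (J j).r (J j).d).filter (fun t => j ∈ edfSched J m' t)).card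
      = (J j).p := by
  intro j
  obtain ⟨S, hS, hwin, hp⟩ := hm
  rw [card_filter_Ico_edfSched]
  have h1α : 0 < 1 - α := by linarith
  have hlag := workDone_sub_edfSched_le (m' := m') hα0 hα1 hloose hS hwin hp
    ((div_le_iff₀ (by positivity)).1 hm') (J j).d (J j).d le_rfl
  rw [sub_self, mul_zero] at hlag
  have hle : workDone S (dueBy J (J j).d) (J j).d ≤
      workDone (edfSched J m') (dueBy J (J j).d) (J j).d := by
    have := nonpos_of_mul_nonpos_right hlag h1α
    exact_mod_cast sub_nonpos.1 this
  have hS_done : ∀ k ∈ dueBy J (J j).d, (J k).p ≤ slotCount S (J j).d k := fun k hk =>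
    (hp k).symm.le.trans (slotCount_mono S k (Finset.mem_filter.1 hk).2)
  refine (slotCount_edfSched_le J m' _ j).antisymm ?_
  by_contra! hlt
  refine hle.not_gt (Finset.sum_lt_sum
    (fun k hk => (slotCount_edfSched_le J m' _ k).trans (hS_done k hk)) ⟨j, ?_, ?_⟩)
  · simp [dueBy]
  · exact hlt.trans_le (hS_done j (by simp [dueBy]))
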